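/- arXiv:2004.10413 — 4 statements merged into one kernel-verified Lean document; each statement's English description precedes it below -/
import Mathlib

section
/- Let N be a Petri net, M a marking, and U = {t1, ..., tn} a finite nonempty set of pairwise distinct transitions that are all enabled at M, have pairwise disjoint presets, and whose firings at M are all contact-free. Then for every ordering (permutation) of t1, ..., tn, the transitions can be fired sequentially from M in that order, and the resulting marking is independent of the order and equals the result of the concurrent step, (M \ ⋃_{t∈U} pre(t)) ∪ ⋃_{t∈U} post(t). -/
/-- A (1-bounded) Petri net with places `P` and transitions `T`. -/
structure PetriNet (P T : Type*) where
  pre : T → Set P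
  post : T → Set P
  pre_fin : ∀ t, (pre t).Finite
  pre_ne : ∀ t, (pre t).Nonempty
  post_fin : ∀ t, (post t).Finite
  post_ne : ∀ t, (post t).Nonempty
  Init : Set P

namespace PetriNet

variable {P T : Type*} (N : PetriNet P T)

/-- A transition `t` is enabled at marking `M` if its preset is contained in `M`. -/
def Enabled (M : Set P) (t : T) : Prop := N.pre t ⊆ M

/-- Firing transition `t` at marking `M` yields `(M \ pre t) ∪ post t`. -/
def fire (M : Set P) (t : T) : Set P := (M \ N.pre t) ∪ N.post t

/-- The firing of `t` at `M` is contact-free if `post t ∩ (M \ pre t) = ∅`. -/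
def ContactFreeAt (M : Set P) (t : T) : Prop := N.post t ∩ (M \ N.pre t) = ∅

/-- `FiresTo N M l M'` : the firing sequence `l` can be fired successively from `M`,
reaching `M'`. -/
inductive FiresTo : Set P → List T → Set P → Prop
  | nil (M : Set P) : FiresTo M [] M
  | cons {M M' : Set P} {t : T} {l : List T} :
      N.Enabled M t → FiresTo (N.fire M t) l M' → FiresTo M (t :: l) M'

/-- The set of sequentially reachable markings. -/
def ReachSeq : Set (Set P) := {M | ∃ l : List T, N.FiresTo N.Init l M}

/-- The net is contact-free (1-safe): every firing of an enabled transition at a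
sequentially reachable marking is contact-free. -/
def ContactFreeNet : Prop :=
  ∀ M ∈ N.ReachSeq, ∀ t : T, N.Enabled M t → N.ContactFreeAt M t

/-- `U` is a nonempty finite set of transitions that are all enabled at `M`
and have pairwise disjoint presets. -/
def ConcEnabled (M : Set P) (U : Set T) : Prop :=
  U.Nonempty ∧ U.Finite ∧ (∀ t ∈ U, N.Enabled M t) ∧
    (∀ t1 ∈ U, ∀ t2 ∈ U, t1 ≠ t2 → N.pre t1 ∩ N.pre t2 = ∅)

/-- The result of the concurrent step firing the set `U` at `M`. -/
def concFire (M : Set P) (U : Set T) : Set P :=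
  (M \ ⋃ t ∈ U, N.pre t) ∪ ⋃ t ∈ U, N.post t

/-- A maximal concurrent step: `U` is maximal among nonempty sets of transitions
enabled at `M` with pairwise disjoint presets, and firing `U` at `M` yields `M'`. -/
def MaxConcStep (M : Set P) (U : Set T) (M' : Set P) : Prop :=
  N.ConcEnabled M U ∧ (∀ V : Set T, N.ConcEnabled M V → U ⊆ V → V = U) ∧
    M' = N.concFire M U

/-- Reachability by a sequence of maximal concurrent steps
(true concurrent flow semantics). -/
inductive TCFiresTo : Set P → Set P → Prop
  | refl (M : Set P) : TCFiresTo M M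
  | step {M M' M'' : Set P} (U : Set T) :
      N.MaxConcStep M U M' → TCFiresTo M' M'' → TCFiresTo M M''

/-- The set of markings reachable under the true concurrent flow semantics. -/
def ReachTC : Set (Set P) := {M | N.TCFiresTo N.Init M}

/-- The net has place out-degree at most one: each place has at most one
outgoing transition. -/
def OutDegOne : Prop := ∀ p : P, ∀ t1 t2 : T, p ∈ N.pre t1 → p ∈ N.pre t2 → t1 = t2

end PetriNet

namespace PetriNet

variable {P T : Type*} (N : PetriNet P T)

/-- An enabled transition keeps being enabled after firing a transition with disjoint preset. -/
theorem Enabled.fire {N : PetriNet P T} {M : Set P} {s t : T} (ht : N.Enabled M t)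
    (hd : Disjoint (N.pre s) (N.pre t)) : N.Enabled (N.fire M s) t :=
  fun _ hp => Or.inl ⟨ht hp, fun hps => Set.disjoint_left.1 hd hps hp⟩

/-- A contact-free firing produces no token in the preset of an enabled transition
with disjoint preset. -/
theorem ContactFreeAt.disjoint_post_pre {N : PetriNet P T} {M : Set P} {s t : T}
    (hs : N.ContactFreeAt M s) (ht : N.Enabled M t) (hd : Disjoint (N.pre s) (N.pre t)) :
    Disjoint (N.post s) (N.pre t) :=
  (Set.disjoint_iff_inter_eq_empty.2 hs).mono_right (Set.subset_sdiff.2 ⟨ht, hd.symm⟩)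

/-- If no transition of `l` touches the presets of the later ones, then firing `l` sequentially
has the same effect as the concurrent step. -/
theorem firesTo_concFire_of_pairwise (l : List T) (M : Set P) (hen : ∀ t ∈ l, N.Enabled M t)
    (hl : l.Pairwise fun s t => Disjoint (N.pre s) (N.pre t) ∧ Disjoint (N.post s) (N.pre t)) :
    N.FiresTo M l (N.concFire M {t | t ∈ l}) := by
  induction l generalizing M with
  | nil => simpa [concFire] using FiresTo.nil M
  | cons a l ih =>
    rw [List.pairwise_cons] at hl
    have h := ih (N.fire M a)
      (fun t ht => (hen t (List.mem_cons_of_mem a ht)).fire (hl.1 t ht).1) hl.2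
    have hpost : Disjoint (N.post a) (⋃ t ∈ {t | t ∈ l}, N.pre t) :=
      Set.disjoint_iUnion₂_right.2 fun t ht => (hl.1 t ht).2
    have hstep : N.concFire M {t | t ∈ a :: l} = N.concFire (N.fire M a) {t | t ∈ l} := by
      have hset : {t | t ∈ a :: l} = insert a {t | t ∈ l} := by
        ext t
        simp
      rw [hset, concFire, concFire, PetriNet.fire, Set.biUnion_insert, Set.biUnion_insert,
        Set.union_sdiff_distrib, hpost.sdiff_eq_left, Set.sdiff_sdiff, Set.union_assoc]
    rw [hstep]
    exact FiresTo.cons (hen a List.mem_cons_self) h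

end PetriNet

/-- a finite nonempty set of transitions, all enabled at `M`, with
pairwise disjoint presets and contact-free firings, can be fired sequentially in
any order, always reaching the marking of the concurrent step. -/
theorem concurrent_step_any_order {P T : Type*} [DecidableEq T]
    (N : PetriNet P T) (M : Set P) (U : Finset T)
    (hne : U.Nonempty)
    (hen : ∀ t ∈ U, N.Enabled M t)
    (hdisj : ∀ t1 ∈ U, ∀ t2 ∈ U, t1 ≠ t2 → N.pre t1 ∩ N.pre t2 = ∅)
    (hcf : ∀ t ∈ U, N.ContactFreeAt M t) :
    ∀ l : List T, l.Nodup → l.toFinset = U →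
      N.FiresTo M l ((M \ ⋃ t ∈ (U : Set T), N.pre t) ∪ ⋃ t ∈ (U : Set T), N.post t) := by
  rintro l hl rfl
  simp only [List.mem_toFinset] at hen hdisj hcf
  rw [List.coe_toFinset]
  refine N.firesTo_concFire_of_pairwise l M hen (hl.imp_of_mem fun {s t} hs ht hst => ?_)
  have hd : Disjoint (N.pre s) (N.pre t) :=
    Set.disjoint_iff_inter_eq_empty.2 (hdisj s hs t ht hst)
  exact ⟨hd, (hcf s hs).disjoint_post_pre (hen t ht) hd⟩
end

section
/- Let N be a contact-free (1-safe) Petri net. Then every marking reachable from Init under the true concurrent flow semantics is also sequentially reachable: Reach_tc(N) ⊆ Reach_seq(N). -/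
namespace PetriNet

variable {P T : Type*} {N : PetriNet P T}

theorem FiresTo.snoc {M M' : Set P} {l : List T} {t : T} (h : N.FiresTo M l M')
    (ht : N.Enabled M' t) : N.FiresTo M (l ++ [t]) (N.fire M' t) := by
  induction h with
  | nil M => exact .cons ht (.nil _)
  | cons hs _ ih => exact .cons hs (ih ht)

theorem fire_mem_reachSeq {M : Set P} {t : T} (hM : M ∈ N.ReachSeq) (ht : N.Enabled M t) :
    N.fire M t ∈ N.ReachSeq := by
  obtain ⟨l, hl⟩ := hM
  exact ⟨l ++ [t], hl.snoc ht⟩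

theorem concFire_empty (M : Set P) : N.concFire M ∅ = M := by
  simp [concFire]

/-- Firing `t` first and then the remaining transitions has the same effect as the concurrent
step, provided that firing `t` produces no token consumed by the remaining transitions. -/
theorem concFire_insert {M : Set P} {t : T} {U : Set T}
    (h : ∀ u ∈ U, Disjoint (N.post t) (N.pre u)) :
    N.concFire M (insert t U) = N.concFire (N.fire M t) U := by
  have h' : Disjoint (N.post t) (⋃ u ∈ U, N.pre u) := Set.disjoint_iUnion₂_right.2 h
  simp only [concFire, fire, Set.biUnion_insert, Set.union_sdiff_distrib, h'.sdiff_eq_left,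
    Set.sdiff_sdiff, Set.union_assoc]

theorem concFire_mem_reachSeq (hcf : N.ContactFreeNet) {U : Set T} (hU : U.Finite) {M : Set P}
    (hM : M ∈ N.ReachSeq) (hen : ∀ t ∈ U, N.Enabled M t)
    (hdisj : U.PairwiseDisjoint N.pre) : N.concFire M U ∈ N.ReachSeq := by
  induction U, hU using Set.Finite.induction_on generalizing M with
  | empty => rwa [concFire_empty]
  | @insert t U htU _ ih =>
    rw [Set.forall_mem_insert] at hen
    obtain ⟨hU, ht⟩ := (Set.pairwiseDisjoint_insert_of_notMem htU).1 hdisj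
    have hpre : ∀ u ∈ U, N.pre u ⊆ M \ N.pre t := fun u hu =>
      Set.subset_sdiff.2 ⟨hen.2 u hu, (ht u hu).symm⟩
    have hpost : Disjoint (N.post t) (M \ N.pre t) :=
      Set.disjoint_iff_inter_eq_empty.2 (hcf M hM t hen.1)
    rw [concFire_insert fun u hu => hpost.mono_right (hpre u hu)]
    exact ih (fire_mem_reachSeq hM hen.1)
      (fun u hu => (hpre u hu).trans Set.subset_union_left) hU

theorem TCFiresTo.mem_reachSeq (hcf : N.ContactFreeNet) {M M' : Set P} (h : N.TCFiresTo M M')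
    (hM : M ∈ N.ReachSeq) : M' ∈ N.ReachSeq := by
  induction h with
  | refl M => exact hM
  | step U hstep _ ih =>
    obtain ⟨⟨-, hfin, hen, hdisj⟩, -, rfl⟩ := hstep
    exact ih (concFire_mem_reachSeq hcf hfin hM hen fun t ht u hu htu =>
      Set.disjoint_iff_inter_eq_empty.2 (hdisj t ht u hu htu))

end PetriNet

/-- in a contact-free (1-safe) Petri net, every marking reachable
under the true concurrent flow semantics is also sequentially reachable. -/
theorem reachTC_subset_reachSeq {P T : Type*} (N : PetriNet P T)
    (hcf : N.ContactFreeNet) :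
    N.ReachTC ⊆ N.ReachSeq := by
  intro M hM
  exact hM.mem_reachSeq hcf ⟨[], .nil _⟩
end

section
/- Let N be a finite Petri net whose flow relation is acyclic, in which every place has at most one incoming transition (for every place p there is at most one transition t with p ∈ post(t)), and in which no place of the initial marking Init has an incoming transition. Then along any firing sequence from Init, each transition of N fires at most once. -/
namespace PetriNet

variable {P T : Type*} (N : PetriNet P T)

/-- The flow relation of a Petri net, on the disjoint union of places
and transitions. -/
def Flow : (P ⊕ T) → (P ⊕ T) → Prop
  | Sum.inl p, Sum.inr t => p ∈ N.pre t
  | Sum.inr t, Sum.inl p => p ∈ N.post t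
  | _, _ => False

/-- The flow relation is acyclic: no directed cycle. -/
def FlowAcyclic : Prop := ∀ x : P ⊕ T, ¬ Relation.TransGen N.Flow x x

end PetriNet

namespace PetriNet

variable {P T : Type*} {N : PetriNet P T}

open scoped Classical in
/-- Token accounting at a place `p` of the preset of `t`: every firing of `t` consumes a token
which is present at the start or produced by some firing along the sequence. -/
theorem FiresTo.count_add_le {M M' : Set P} {l : List T} (h : N.FiresTo M l M') {p : P} {t : T}
    (hp : p ∈ N.pre t) :
    l.count t + (if p ∈ M' then 1 else 0) ≤
      (if p ∈ M then 1 else 0) + l.countP (p ∈ N.post ·) := by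
  induction h with
  | nil M => simp
  | @cons M M' u l hu _ ih =>
    have key : (if u = t then 1 else 0) + (if p ∈ N.fire M u then 1 else 0) ≤
        (if p ∈ M then 1 else 0) + (if p ∈ N.post u then 1 else 0) := by
      by_cases hut : u = t
      · subst hut
        simp [fire, hp, hu hp]
      · by_cases h1 : p ∈ M <;> by_cases h2 : p ∈ N.post u <;> by_cases h3 : p ∈ N.pre u <;>
          simp [fire, hut, h1, h2, h3]
    simp only [List.count_cons, List.countP_cons, beq_iff_eq, decide_eq_true_eq]
    omega

/-- In a finite net with acyclic flow, causal precedence of transitions is well-founded. -/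
theorem FlowAcyclic.wellFounded [Finite T] (h : N.FlowAcyclic) :
    WellFounded fun s t : T => Relation.TransGen N.Flow (Sum.inr s) (Sum.inr t) :=
  haveI : IsTrans T fun s t => Relation.TransGen N.Flow (Sum.inr s) (Sum.inr t) :=
    ⟨fun _ _ _ => Relation.TransGen.trans⟩
  haveI : Std.Irrefl fun s t : T => Relation.TransGen N.Flow (Sum.inr s) (Sum.inr t) :=
    ⟨fun t => h (Sum.inr t)⟩
  Finite.wellFounded_of_trans_of_irrefl _

end PetriNet

/-- in a finite Petri net with acyclic flow relation, in which each
place has at most one incoming transition and the initially marked places have no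
incoming transition, every transition fires at most once along any firing sequence
from `Init`. -/
theorem fires_at_most_once {P T : Type*} [Finite P] [Finite T] (N : PetriNet P T)
    (hacyc : N.FlowAcyclic)
    (hin : ∀ (p : P) (t1 t2 : T), p ∈ N.post t1 → p ∈ N.post t2 → t1 = t2)
    (hinit : ∀ p ∈ N.Init, ∀ t : T, p ∉ N.post t) :
    ∀ (l : List T) (M : Set P), N.FiresTo N.Init l M → l.Nodup := by
  classical
  intro l M h
  refine List.nodup_iff_count_le_one.2 fun t => ?_
  induction t using hacyc.wellFounded.induction with
  | _ t ih =>
    obtain ⟨p, hp⟩ := N.pre_ne t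
    have hle := h.count_add_le hp
    by_cases hs : ∃ s, p ∈ N.post s
    · obtain ⟨s, hs⟩ := hs
      have hpInit : p ∉ N.Init := fun hI => hinit p hI s hs
      have hst : Relation.TransGen N.Flow (Sum.inr s) (Sum.inr t) :=
        .tail (.single (show N.Flow (Sum.inr s) (Sum.inl p) from hs)) hp
      have hcount : l.countP (p ∈ N.post ·) ≤ l.count s :=
        List.countP_mono_left fun u _ hu => by
          simpa using hin p u s (by simpa using hu) hs
      have := ih s hst
      rw [if_neg hpInit] at hle
      omega
    · have hcount : l.countP (p ∈ N.post ·) = 0 :=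
        List.countP_eq_zero.2 fun u _ hu => hs ⟨u, by simpa using hu⟩
      split_ifs at hle <;> omega
end

section
/- Let N be a finite Petri net whose flow relation is acyclic, in which every place has at most one incoming transition (for every place p there is at most one transition t with p ∈ post(t)), and in which no place of the initial marking Init has an incoming transition. Then along any firing sequence from Init, for each place p at most one transition t with p ∈ pre(t) fires; hence the transitions fired along the sequence determine a choice function that selects at most one outgoing transition at every place (as required of environment strategies, which choose at most one outgoing transition per environment place). -/
namespace PetriNet

variable {P T : Type*} (N : PetriNet P T)

/-- Occurrence-net bookkeeping for a marking `M` reached after firing exactly the transitions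
in `H`: marked places have not been consumed, every place marked so far is initial or produced
by `H`, and no two distinct transitions of `H` share an input place. -/
structure History (H : Set T) (M : Set P) : Prop where
  not_consumed : ∀ p ∈ M, ∀ u ∈ H, p ∉ N.pre u
  marked_origin : ∀ p ∈ M, p ∈ N.Init ∨ ∃ t ∈ H, p ∈ N.post t
  consumed_origin : ∀ u ∈ H, ∀ p ∈ N.pre u, p ∈ N.Init ∨ ∃ t ∈ H, p ∈ N.post t
  conflict_free : ∀ p, ∀ t1 ∈ H, ∀ t2 ∈ H, p ∈ N.pre t1 → p ∈ N.pre t2 → t1 = t2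

variable {N}

theorem History.init : N.History ∅ N.Init where
  not_consumed := by simp
  marked_origin p hp := Or.inl hp
  consumed_origin := by simp
  conflict_free := by simp

theorem History.fire {H : Set T} {M : Set P} {t : T} (h : N.History H M)
    (hin : ∀ (p : P) (t1 t2 : T), p ∈ N.post t1 → p ∈ N.post t2 → t1 = t2)
    (hinit : ∀ p ∈ N.Init, ∀ t : T, p ∉ N.post t) (ht : N.Enabled M t) :
    N.History (insert t H) (N.fire M t) := by
  have fresh : t ∉ H := fun htH =>
    let ⟨p, hp⟩ := N.pre_ne t
    h.not_consumed p (ht hp) t htH hp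
  have not_origin : ∀ p ∈ N.post t, ¬ (p ∈ N.Init ∨ ∃ u ∈ H, p ∈ N.post u) := by
    rintro p hp (hpi | ⟨u, hu, hpu⟩)
    · exact hinit p hpi t hp
    · exact fresh (hin p t u hp hpu ▸ hu)
  have mono : ∀ p, (p ∈ N.Init ∨ ∃ u ∈ H, p ∈ N.post u) →
      p ∈ N.Init ∨ ∃ u ∈ insert t H, p ∈ N.post u := fun p =>
    Or.imp_right fun ⟨u, hu, hpu⟩ => ⟨u, Set.mem_insert_of_mem t hu, hpu⟩
  refine ⟨?_, ?_, ?_, ?_⟩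
  · rintro p (⟨hpM, hpt⟩ | hp) u (rfl | hu) hpu
    · exact hpt hpu
    · exact h.not_consumed p hpM u hu hpu
    · exact not_origin p hp (h.marked_origin p (ht hpu))
    · exact not_origin p hp (h.consumed_origin u hu p hpu)
  · rintro p (⟨hpM, -⟩ | hp)
    · exact mono p (h.marked_origin p hpM)
    · exact Or.inr ⟨t, Set.mem_insert t H, hp⟩
  · rintro u (rfl | hu) p hp
    · exact mono p (h.marked_origin p (ht hp))
    · exact mono p (h.consumed_origin u hu p hp)
  · rintro p t1 (rfl | h1) t2 (rfl | h2) hp1 hp2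
    · rfl
    · exact absurd hp2 (h.not_consumed p (ht hp1) t2 h2)
    · exact absurd hp1 (h.not_consumed p (ht hp2) t1 h1)
    · exact h.conflict_free p t1 h1 t2 h2 hp1 hp2

theorem History.firesTo {H : Set T} {M M' : Set P} {l : List T} (h : N.History H M)
    (hin : ∀ (p : P) (t1 t2 : T), p ∈ N.post t1 → p ∈ N.post t2 → t1 = t2)
    (hinit : ∀ p ∈ N.Init, ∀ t : T, p ∉ N.post t) (hl : N.FiresTo M l M') :
    N.History (H ∪ {t | t ∈ l}) M' := by
  induction hl generalizing H with
  | nil M => simpa using h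
  | @cons M M' t l ht _ ih =>
    have key : H ∪ {u | u ∈ t :: l} = insert t H ∪ {u | u ∈ l} := by
      ext u
      simp only [Set.mem_union, Set.mem_ofPred_eq, List.mem_cons, Set.mem_insert_iff]
      tauto
    exact key ▸ ih (h.fire hin hinit ht)

end PetriNet

/-- in a finite Petri net with acyclic flow relation, in which each
place has at most one incoming transition and the initially marked places have no
incoming transition, along any firing sequence from `Init` at most one outgoing
transition of each place fires. -/
theorem at_most_one_outgoing_fires {P T : Type*} [Finite P] [Finite T]
    (N : PetriNet P T)
    (hacyc : N.FlowAcyclic)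
    (hin : ∀ (p : P) (t1 t2 : T), p ∈ N.post t1 → p ∈ N.post t2 → t1 = t2)
    (hinit : ∀ p ∈ N.Init, ∀ t : T, p ∉ N.post t) :
    ∀ (l : List T) (M : Set P), N.FiresTo N.Init l M →
      ∀ p : P, ∀ t1 ∈ l, ∀ t2 ∈ l, p ∈ N.pre t1 → p ∈ N.pre t2 → t1 = t2 := by
  intro l M hl p t1 h1 t2 h2
  exact (PetriNet.History.init.firesTo hin hinit hl).conflict_free p t1 (Or.inr h1) t2 (Or.inr h2)
end
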